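/- arXiv:2605.12157 — 7 statements merged into one kernel-verified Lean document; each statement's English description precedes it below -/
import Mathlib

section
/- (Multiplication by t^α) Let 0 < α ≤ 1, let f : (0,∞) → ℂ be measurable, and suppose there are constants M > 0 and a ∈ ℝ with |f(t)| ≤ M·exp(a·t^α/α) for all t > 0. Then for every real s > a the function F_α(s) = ∫₀^∞ exp(−s·t^α/α)·t^(α−1)·f(t) dt is differentiable at s with derivative F_α'(s) = −(1/α)·∫₀^∞ exp(−s·t^α/α)·t^(α−1)·t^α·f(t) dt; equivalently L_0^α{t^α·f(t)}(s) = −α·(d/ds)L_0^α{f}(s). -/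
open MeasureTheory

/-- An exponentially bounded integrand decays exponentially after multiplication by the
transform kernel. -/
lemma norm_exp_neg_mul_mul_le {z : ℂ} {M a c σ u : ℝ} (hM : 0 ≤ M) (hu : 0 ≤ u)
    (hz : ‖z‖ ≤ M * Real.exp (a * u)) (hσ : c ≤ σ) :
    ‖Complex.exp (-(σ : ℂ) * (u : ℂ)) * z‖ ≤ M * Real.exp (-(c - a) * u) := by
  rw [norm_mul, ← Complex.ofReal_neg, ← Complex.ofReal_mul, Complex.norm_exp_ofReal]
  calc Real.exp (-σ * u) * ‖z‖ ≤ Real.exp (-σ * u) * (M * Real.exp (a * u)) := by gcongr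
    _ = M * Real.exp (-σ * u + a * u) := by rw [Real.exp_add]; ring
    _ ≤ M * Real.exp (-(c - a) * u) := by
      gcongr
      nlinarith

/-- Multiplying the kernel bound by a nonnegative real weight. -/
lemma norm_exp_neg_mul_mul_mul_le {z : ℂ} {M a c σ u w : ℝ} (hM : 0 ≤ M) (hu : 0 ≤ u)
    (hw : 0 ≤ w) (hz : ‖z‖ ≤ M * Real.exp (a * u)) (hσ : c ≤ σ) :
    ‖Complex.exp (-(σ : ℂ) * (u : ℂ)) * (w : ℂ) * z‖ ≤
      M * (w * Real.exp (-(c - a) * u)) := by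
  rw [mul_right_comm, norm_mul, Complex.norm_of_nonneg hw]
  calc _ ≤ M * Real.exp (-(c - a) * u) * w := by
        gcongr
        exact norm_exp_neg_mul_mul_le hM hu hz hσ
    _ = _ := by ring

lemma integrableOn_rpow_mul_exp_neg_mul_rpow_div {α p b : ℝ} (hα : 0 < α) (hp : -1 < p)
    (hb : 0 < b) (M : ℝ) :
    IntegrableOn (fun t : ℝ => M * (t ^ p * Real.exp (-b * (t ^ α / α)))) (Set.Ioi 0) := by
  refine ((integrableOn_rpow_mul_exp_neg_mul_rpow hp hα (div_pos hb hα)).const_mul M).congr ?_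
  refine Filter.Eventually.of_forall fun t => ?_
  have h : -(b / α) * t ^ α = -b * (t ^ α / α) := by ring
  simp only [h]

/-- Multiplication by `t^α`: the conformable Laplace transform `F_α` is differentiable at
every real `s > a` with `F_α'(s) = −(1/α)·L_0^α{t^α·f(t)}(s)`, i.e.
`L_0^α{t^α·f(t)}(s) = −α·(d/ds) L_0^α{f}(s)`. -/
theorem conformableLaplace_mul_rpow
    (α : ℝ) (hα0 : 0 < α) (hα1 : α ≤ 1) (f : ℝ → ℂ) (hf : Measurable f)
    (M a : ℝ) (hM : 0 < M)
    (hbound : ∀ t : ℝ, 0 < t → ‖f t‖ ≤ M * Real.exp (a * (t ^ α / α)))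
    (s : ℝ) (hs : a < s) :
    HasDerivAt
      (fun σ : ℝ => ∫ t in Set.Ioi (0 : ℝ),
        Complex.exp (-(σ : ℂ) * ((t ^ α / α : ℝ) : ℂ)) * ((t ^ (α - 1) : ℝ) : ℂ) * f t)
      (-((1 / α : ℝ) : ℂ) *
        ∫ t in Set.Ioi (0 : ℝ),
          Complex.exp (-(s : ℂ) * ((t ^ α / α : ℝ) : ℂ)) * ((t ^ (α - 1) : ℝ) : ℂ) *
            ((t ^ α : ℝ) : ℂ) * f t)
      s := by
  obtain ⟨c, hac, hcs⟩ := exists_between hs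
  have hmeas : ∀ σ : ℝ, Measurable fun t : ℝ =>
      Complex.exp (-(σ : ℂ) * ((t ^ α / α : ℝ) : ℂ)) * ((t ^ (α - 1) : ℝ) : ℂ) * f t := by
    intro σ
    fun_prop
  have hmeas' : Measurable fun t : ℝ => -((1 / α : ℝ) : ℂ) *
      (Complex.exp (-(s : ℂ) * ((t ^ α / α : ℝ) : ℂ)) * ((t ^ (α - 1) : ℝ) : ℂ) *
        ((t ^ α : ℝ) : ℂ) * f t) := by
    fun_prop
  rw [← integral_const_mul]
  refine (hasDerivAt_integral_of_dominated_loc_of_deriv_le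
    (F' := fun (σ : ℝ) (t : ℝ) => -((1 / α : ℝ) : ℂ) *
      (Complex.exp (-(σ : ℂ) * ((t ^ α / α : ℝ) : ℂ)) * ((t ^ (α - 1) : ℝ) : ℂ) *
        ((t ^ α : ℝ) : ℂ) * f t))
    (bound := fun t => 1 / α * (M * (t ^ (α - 1 + α) * Real.exp (-(c - a) * (t ^ α / α)))))
    (Ioi_mem_nhds hcs) (Filter.Eventually.of_forall fun σ => (hmeas σ).aestronglyMeasurable)
    ?_ hmeas'.aestronglyMeasurable ?_ ?_ ?_).2
  · refine (integrableOn_rpow_mul_exp_neg_mul_rpow_div hα0 (p := α - 1) (by linarith)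
      (sub_pos.2 hac) M).mono' (hmeas s).aestronglyMeasurable ?_
    refine (ae_restrict_mem measurableSet_Ioi).mono fun t (ht : 0 < t) => ?_
    exact norm_exp_neg_mul_mul_mul_le hM.le (by positivity) (by positivity) (hbound t ht) hcs.le
  · refine (ae_restrict_mem measurableSet_Ioi).mono fun t (ht : 0 < t) σ (hσ : c < σ) => ?_
    rw [norm_mul, norm_neg, Complex.norm_of_nonneg (by positivity : 0 ≤ 1 / α),
      mul_assoc (Complex.exp _), ← Complex.ofReal_mul, ← Real.rpow_add ht]
    gcongr
    exact norm_exp_neg_mul_mul_mul_le hM.le (by positivity) (by positivity) (hbound t ht) hσ.le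
  · exact (integrableOn_rpow_mul_exp_neg_mul_rpow_div hα0 (by linarith)
      (sub_pos.2 hac) M).const_mul _
  · refine Filter.Eventually.of_forall fun t σ _ => ?_
    have h := (((((hasDerivAt_id σ).ofReal_comp).neg.mul_const
      ((t ^ α / α : ℝ) : ℂ)).cexp).mul_const ((t ^ (α - 1) : ℝ) : ℂ)).mul_const (f t)
    refine h.congr_deriv ?_
    simp only [id, Pi.neg_apply]
    push_cast
    ring
end

section
/- (Division by t^α) Let 0 < α ≤ 1, let f : (0,∞) → ℂ be measurable, and suppose there are constants M > 0 and a ∈ ℝ with |f(t)| ≤ M·t^α·exp(a·t^α/α) for all t > 0. Then for every real s > a, ∫_s^∞ ( ∫₀^∞ exp(−σ·t^α/α)·t^(α−1)·f(t) dt ) dσ = α·∫₀^∞ exp(−s·t^α/α)·t^(α−1)·(f(t)/t^α) dt; that is, L_0^α{f(t)/t^α}(s) = (1/α)·∫_s^∞ L_0^α{f}(σ) dσ. -/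
open MeasureTheory

theorem integrableOn_rpow_mul_exp_mul_rpow_div {α c : ℝ} (hα : 0 < α) (hc : c < 0) :
    IntegrableOn (fun t : ℝ => t ^ (α - 1) * Real.exp (c * (t ^ α / α))) (Set.Ioi 0) := by
  have h := (integrableOn_Ioi_comp_rpow_iff' (fun x : ℝ => Real.exp (c / α * x)) hα.ne').2
    (integrableOn_exp_mul_Ioi (div_neg_of_neg_of_pos hc hα) 0)
  refine h.congr_fun (fun t _ => ?_) measurableSet_Ioi
  simp only [smul_eq_mul]
  congr 2
  ring

theorem norm_conformableLaplace_kernel (α σ : ℝ) (f : ℝ → ℂ) {t : ℝ} (ht : 0 < t) :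
    ‖Complex.exp (-(σ : ℂ) * ((t ^ α / α : ℝ) : ℂ)) * ((t ^ (α - 1) : ℝ) : ℂ) * f t‖ =
      Real.exp (-(t ^ α / α) * σ) * (t ^ (α - 1) * ‖f t‖) := by
  rw [norm_mul, norm_mul, ← Complex.ofReal_neg, ← Complex.ofReal_mul, Complex.norm_exp,
    Complex.ofReal_re, Complex.norm_real, Real.norm_of_nonneg (by positivity)]
  ring_nf

theorem integrable_conformableLaplace_kernel_prod {α : ℝ} (hα : 0 < α) {f : ℝ → ℂ}
    (hf : Measurable f) {M a s : ℝ}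
    (hbound : ∀ t : ℝ, 0 < t → ‖f t‖ ≤ M * t ^ α * Real.exp (a * (t ^ α / α)))
    (hs : a < s) :
    Integrable (Function.uncurry fun σ t : ℝ =>
        Complex.exp (-(σ : ℂ) * ((t ^ α / α : ℝ) : ℂ)) * ((t ^ (α - 1) : ℝ) : ℂ) * f t)
      ((volume.restrict (Set.Ioi s)).prod (volume.restrict (Set.Ioi 0))) := by
  have hmeas : Measurable (Function.uncurry fun σ t : ℝ =>
      Complex.exp (-(σ : ℂ) * ((t ^ α / α : ℝ) : ℂ)) * ((t ^ (α - 1) : ℝ) : ℂ) * f t) := by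
    unfold Function.uncurry
    fun_prop
  rw [integrable_prod_iff' hmeas.aestronglyMeasurable]
  constructor
  · filter_upwards [ae_restrict_mem measurableSet_Ioi] with t (ht : 0 < t)
    have hu : 0 < t ^ α / α := by positivity
    refine (integrable_norm_iff
      (hmeas.comp measurable_prodMk_right).aestronglyMeasurable).1 ?_
    simp only [Function.comp_def, Function.uncurry_apply_pair,
      norm_conformableLaplace_kernel α _ f ht]
    exact (integrableOn_exp_mul_Ioi (neg_lt_zero.2 hu) s).mul_const _
  · refine ((integrableOn_rpow_mul_exp_mul_rpow_div hα (sub_neg.2 hs)).const_mul (α * M)).mono'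
      hmeas.norm.stronglyMeasurable.integral_prod_left'.aestronglyMeasurable ?_
    filter_upwards [ae_restrict_mem measurableSet_Ioi] with t (ht : 0 < t)
    have hu : 0 < t ^ α / α := by positivity
    have htα : 0 < t ^ α := by positivity
    rw [Real.norm_of_nonneg (integral_nonneg fun _ => norm_nonneg _)]
    simp only [Function.uncurry_apply_pair, norm_conformableLaplace_kernel α _ f ht]
    rw [integral_mul_const, integral_exp_mul_Ioi (neg_lt_zero.2 hu), neg_div_neg_eq]
    calc Real.exp (-(t ^ α / α) * s) / (t ^ α / α) * (t ^ (α - 1) * ‖f t‖)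
        ≤ Real.exp (-(t ^ α / α) * s) / (t ^ α / α) *
            (t ^ (α - 1) * (M * t ^ α * Real.exp (a * (t ^ α / α)))) := by
          gcongr
          exact hbound t ht
      _ = α * M * (t ^ (α - 1) *
            (Real.exp (-(t ^ α / α) * s) * Real.exp (a * (t ^ α / α)))) := by
          field_simp
      _ = α * M * (t ^ (α - 1) * Real.exp ((a - s) * (t ^ α / α))) := by
          rw [← Real.exp_add]
          ring_nf

/-- Division by `t^α`: `L_0^α{f(t)/t^α}(s) = (1/α)·∫_s^∞ L_0^α{f}(σ) dσ`, stated as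
`∫_s^∞ L_0^α{f}(σ) dσ = α · L_0^α{f(t)/t^α}(s)` for real `s > a`. -/
theorem conformableLaplace_div_rpow
    (α : ℝ) (hα0 : 0 < α) (hα1 : α ≤ 1) (f : ℝ → ℂ) (hf : Measurable f)
    (M a : ℝ) (hM : 0 < M)
    (hbound : ∀ t : ℝ, 0 < t → ‖f t‖ ≤ M * t ^ α * Real.exp (a * (t ^ α / α)))
    (s : ℝ) (hs : a < s) :
    ∫ σ in Set.Ioi s,
        (∫ t in Set.Ioi (0 : ℝ),
          Complex.exp (-(σ : ℂ) * ((t ^ α / α : ℝ) : ℂ)) * ((t ^ (α - 1) : ℝ) : ℂ) * f t) =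
    (α : ℂ) *
      ∫ t in Set.Ioi (0 : ℝ),
        Complex.exp (-(s : ℂ) * ((t ^ α / α : ℝ) : ℂ)) * ((t ^ (α - 1) : ℝ) : ℂ) *
          (f t / ((t ^ α : ℝ) : ℂ)) := by
  rw [integral_integral_swap (integrable_conformableLaplace_kernel_prod hα0 hf hbound hs),
    ← integral_const_mul]
  refine setIntegral_congr_fun measurableSet_Ioi fun t (ht : 0 < t) => ?_
  have hu : 0 < t ^ α / α := by positivity
  have htα : ((t ^ α : ℝ) : ℂ) ≠ 0 := Complex.ofReal_ne_zero.2 (by positivity)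
  have hα : (α : ℂ) ≠ 0 := Complex.ofReal_ne_zero.2 hα0.ne'
  have hexp := integral_exp_mul_complex_Ioi (a := -((t ^ α / α : ℝ) : ℂ))
    (by rw [← Complex.ofReal_neg, Complex.ofReal_re]; exact neg_lt_zero.2 hu) s
  simp only [neg_mul, mul_comm ((t ^ α / α : ℝ) : ℂ), neg_div_neg_eq] at hexp
  simp only [neg_mul, integral_mul_const, hexp]
  rw [Complex.ofReal_div]
  field_simp
end

section
/- (Uniqueness) Let 0 < α ≤ 1 and let f, g : [0,∞) → ℂ be continuous functions for which there exist constants M > 0 and a ∈ ℝ with |f(t)| ≤ M·exp(a·t^α/α) and |g(t)| ≤ M·exp(a·t^α/α) for all t ≥ 0. If ∫₀^∞ exp(−s·t^α/α)·t^(α−1)·f(t) dt = ∫₀^∞ exp(−s·t^α/α)·t^(α−1)·g(t) dt for all real s > a, then f(t) = g(t) for all t ≥ 0. -/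
open MeasureTheory

open Set in
/-- A continuous real function on `[0,1]` all of whose moments vanish is zero. -/
lemma eq_zero_of_moments_eq_zero {G : ℝ → ℝ} (hG : ContinuousOn G (Icc 0 1))
    (h : ∀ n : ℕ, ∫ x in (0 : ℝ)..1, x ^ n * G x = 0) :
    ∀ x ∈ Icc (0 : ℝ) 1, G x = 0 := by
  have hG' : ContinuousOn G (uIcc 0 1) := by rwa [uIcc_of_le zero_le_one]
  have hint (p : Polynomial ℝ) :
      IntervalIntegrable (fun x => p.eval x * G x) volume 0 1 :=
    (p.continuous.continuousOn.mul hG').intervalIntegrable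
  have hpoly (p : Polynomial ℝ) : ∫ x in (0 : ℝ)..1, p.eval x * G x = 0 := by
    induction p using Polynomial.induction_on' with
    | add p q hp hq =>
      simp only [Polynomial.eval_add, add_mul]
      rw [intervalIntegral.integral_add (hint p) (hint q), hp, hq, add_zero]
    | monomial n c =>
      simp only [Polynomial.eval_monomial, mul_assoc]
      rw [intervalIntegral.integral_const_mul, h, mul_zero]
  have hsq : IntervalIntegrable (fun x => G x * G x) volume 0 1 :=
    (hG'.mul hG').intervalIntegrable
  have habs : IntervalIntegrable (fun x => |G x|) volume 0 1 := hG'.abs.intervalIntegrable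
  have hle : ∀ ε > 0, ∫ x in (0 : ℝ)..1, G x * G x ≤ ε * ∫ x in (0 : ℝ)..1, |G x| := by
    intro ε hε
    obtain ⟨p, hp⟩ := exists_polynomial_near_of_continuousOn 0 1 G hG ε hε
    have hsub : ∫ x in (0 : ℝ)..1, G x * G x
        = ∫ x in (0 : ℝ)..1, (G x * G x - p.eval x * G x) := by
      rw [intervalIntegral.integral_sub hsq (hint p), hpoly, sub_zero]
    rw [hsub, ← intervalIntegral.integral_const_mul]
    refine intervalIntegral.integral_mono_on zero_le_one (hsq.sub (hint p))
      (habs.const_mul ε) fun x hx => ?_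
    calc G x * G x - p.eval x * G x ≤ |G x * G x - p.eval x * G x| := le_abs_self _
      _ = |p.eval x - G x| * |G x| := by
        rw [← sub_mul, abs_mul, abs_sub_comm]
      _ ≤ ε * |G x| := by gcongr; exact (hp x hx).le
  have hB : 0 ≤ ∫ x in (0 : ℝ)..1, |G x| :=
    intervalIntegral.integral_nonneg zero_le_one fun x _ => abs_nonneg _
  by_contra! hne
  obtain ⟨c, hc, hGc⟩ := hne
  have hpos : 0 < ∫ x in (0 : ℝ)..1, G x * G x :=
    intervalIntegral.integral_pos zero_lt_one (hG.mul hG)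
      (fun x _ => mul_self_nonneg _) ⟨c, hc, mul_self_pos.2 hGc⟩
  set J := ∫ x in (0 : ℝ)..1, G x * G x
  set B := ∫ x in (0 : ℝ)..1, |G x|
  have h1 := hle (J / (2 * (B + 1))) (by positivity)
  rw [div_mul_eq_mul_div, le_div_iff₀ (by positivity)] at h1
  nlinarith

open Set in
/-- A continuous complex function on `[0,1]` all of whose moments vanish is zero. -/
lemma eq_zero_of_complex_moments_eq_zero {G : ℝ → ℂ} (hG : ContinuousOn G (Icc 0 1))
    (h : ∀ n : ℕ, ∫ x in (0 : ℝ)..1, ((x ^ n : ℝ) : ℂ) * G x = 0) :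
    ∀ x ∈ Icc (0 : ℝ) 1, G x = 0 := by
  have hint (n : ℕ) :
      IntervalIntegrable (fun x : ℝ => ((x ^ n : ℝ) : ℂ) * G x) volume 0 1 := by
    refine ContinuousOn.intervalIntegrable ?_
    rw [uIcc_of_le zero_le_one]
    exact (by fun_prop : Continuous fun x : ℝ => ((x ^ n : ℝ) : ℂ)).continuousOn.mul hG
  have hre := eq_zero_of_moments_eq_zero (G := fun x => (G x).re)
    (Complex.continuous_re.comp_continuousOn hG) fun n => by
      have := Complex.reCLM.intervalIntegral_comp_comm (hint n)
      rw [h n] at this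
      simpa [-Complex.ofReal_pow] using this
  have him := eq_zero_of_moments_eq_zero (G := fun x => (G x).im)
    (Complex.continuous_im.comp_continuousOn hG) fun n => by
      have := Complex.imCLM.intervalIntegral_comp_comm (hint n)
      rw [h n] at this
      simpa [-Complex.ofReal_pow] using this
  exact fun x hx => Complex.ext (hre x hx) (him x hx)

/-- The function on `[0,1]` whose moments are values of the conformable Laplace transform of `f`,
obtained from the substitution `x = exp (-t ^ α / α)`. -/
noncomputable def conformablePullback (α a : ℝ) (f : ℝ → ℂ) (x : ℝ) : ℂ :=
  (x : ℂ) * (((x ^ a : ℝ) : ℂ) * f ((α * -Real.log x) ^ α⁻¹))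

lemma rpow_inv_conformable {α t : ℝ} (hα : 0 < α) (ht : 0 ≤ t) :
    (α * -Real.log (Real.exp (-(t ^ α / α)))) ^ α⁻¹ = t := by
  rw [Real.log_exp, neg_neg, mul_div_cancel₀ _ hα.ne', Real.rpow_rpow_inv ht hα.ne']

lemma conformable_rpow_inv {α x : ℝ} (hα : 0 < α) (hx0 : 0 < x) (hx1 : x ≤ 1) :
    ((α * -Real.log x) ^ α⁻¹) ^ α / α = -Real.log x := by
  have := Real.log_nonpos hx0.le hx1
  rw [Real.rpow_inv_rpow (mul_nonneg hα.le (by linarith)) hα.ne', mul_div_cancel_left₀ _ hα.ne']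

lemma norm_conformablePullback_le {α a M : ℝ} {f : ℝ → ℂ} (hα : 0 < α)
    (hfb : ∀ t : ℝ, 0 ≤ t → ‖f t‖ ≤ M * Real.exp (a * (t ^ α / α)))
    {x : ℝ} (hx : x ∈ Set.Icc (0 : ℝ) 1) : ‖conformablePullback α a f x‖ ≤ M * x := by
  obtain rfl | hx0 := hx.1.eq_or_lt
  · simp [conformablePullback]
  have hlog := Real.log_nonpos hx.1 hx.2
  have h := hfb ((α * -Real.log x) ^ α⁻¹)
    (Real.rpow_nonneg (mul_nonneg hα.le (by linarith)) _)
  rw [conformable_rpow_inv hα hx0 hx.2] at h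
  have hxa : 0 < x ^ a := Real.rpow_pos_of_pos hx0 a
  have hexp : Real.exp (a * -Real.log x) * x ^ a = 1 := by
    rw [Real.rpow_def_of_pos hx0, ← Real.exp_add]
    simp [mul_comm]
  rw [conformablePullback, norm_mul, norm_mul, Complex.norm_real, Complex.norm_real,
    Real.norm_of_nonneg hx.1, Real.norm_of_nonneg hxa.le]
  calc x * (x ^ a * ‖f ((α * -Real.log x) ^ α⁻¹)‖)
      ≤ x * (x ^ a * (M * Real.exp (a * -Real.log x))) := by gcongr
    _ = M * x * (Real.exp (a * -Real.log x) * x ^ a) := by ring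
    _ = M * x := by rw [hexp, mul_one]

lemma continuousOn_conformablePullback {α a M : ℝ} {f : ℝ → ℂ} (hα : 0 < α)
    (hfc : ContinuousOn f (Set.Ici 0))
    (hfb : ∀ t : ℝ, 0 ≤ t → ‖f t‖ ≤ M * Real.exp (a * (t ^ α / α))) :
    ContinuousOn (conformablePullback α a f) (Set.Icc 0 1) := by
  intro x hx
  obtain rfl | hx0 := hx.1.eq_or_lt
  · have h0 : conformablePullback α a f 0 = 0 := by simp [conformablePullback]
    rw [ContinuousWithinAt, h0]
    refine squeeze_zero_norm' (a := fun x => M * x) ?_ ?_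
    · filter_upwards [self_mem_nhdsWithin] with y hy
      exact norm_conformablePullback_le hα hfb hy
    · have : Continuous fun x : ℝ => M * x := by fun_prop
      simpa using (this.tendsto 0).mono_left nhdsWithin_le_nhds
  · have hlog : ContinuousWithinAt (fun y : ℝ => (α * -Real.log y) ^ α⁻¹) (Set.Icc 0 1) x :=
      (((Real.continuousAt_log hx0.ne').neg.const_mul α).rpow_const
        (Or.inr (inv_nonneg.2 hα.le))).continuousWithinAt
    have hmaps : Set.MapsTo (fun y : ℝ => (α * -Real.log y) ^ α⁻¹) (Set.Icc 0 1)
        (Set.Ici 0) := fun y hy =>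
      Real.rpow_nonneg (mul_nonneg hα.le (neg_nonneg.2 (Real.log_nonpos hy.1 hy.2))) _
    have hf : ContinuousWithinAt (fun y : ℝ => f ((α * -Real.log y) ^ α⁻¹)) (Set.Icc 0 1) x :=
      ContinuousWithinAt.comp (g := f) (hfc _ (hmaps hx)) hlog hmaps
    have hpow : ContinuousWithinAt (fun y : ℝ => ((y ^ a : ℝ) : ℂ)) (Set.Icc 0 1) x :=
      (Complex.continuous_ofReal.continuousAt.comp
        (Real.continuousAt_rpow_const x a (Or.inl hx0.ne'))).continuousWithinAt
    exact Complex.continuous_ofReal.continuousWithinAt.mul (hpow.mul hf)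

lemma image_exp_neg_conformable {α : ℝ} (hα : 0 < α) :
    (fun t : ℝ => Real.exp (-(t ^ α / α))) '' Set.Ioi 0 = Set.Ioo 0 1 := by
  ext x
  constructor
  · rintro ⟨t, ht, rfl⟩
    have : 0 < t ^ α / α := div_pos (Real.rpow_pos_of_pos ht α) hα
    exact ⟨Real.exp_pos _, Real.exp_lt_one_iff.2 (by linarith)⟩
  · rintro ⟨hx0, hx1⟩
    have hlog := Real.log_neg hx0 hx1
    refine ⟨(α * -Real.log x) ^ α⁻¹,
      Real.rpow_pos_of_pos (mul_pos hα (by linarith)) _, ?_⟩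
    simp only
    rw [conformable_rpow_inv hα hx0 hx1.le, neg_neg, Real.exp_log hx0]

/-- The moments of the pullback are values of the conformable Laplace transform. -/
lemma integral_pow_mul_conformablePullback {α : ℝ} (a : ℝ) (f : ℝ → ℂ) (hα : 0 < α) (n : ℕ) :
    ∫ x in (0 : ℝ)..1, ((x ^ n : ℝ) : ℂ) * conformablePullback α a f x =
      ∫ t in Set.Ioi (0 : ℝ), Complex.exp (-((a + 2 + n : ℝ) : ℂ) * ((t ^ α / α : ℝ) : ℂ)) *
        ((t ^ (α - 1) : ℝ) : ℂ) * f t := by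
  rw [intervalIntegral.integral_of_le zero_le_one, integral_Ioc_eq_integral_Ioo,
    ← image_exp_neg_conformable hα,
    integral_image_eq_integral_deriv_smul_of_antitoneOn
      (f' := fun t => -(t ^ (α - 1) * Real.exp (-(t ^ α / α)))) measurableSet_Ioi]
  · refine setIntegral_congr_fun measurableSet_Ioi fun t ht => ?_
    have ht0 : 0 < t := ht
    simp only [conformablePullback, rpow_inv_conformable hα ht0.le, neg_neg]
    have hexp : Complex.exp (-((a + 2 + n : ℝ) : ℂ) * ((t ^ α / α : ℝ) : ℂ)) =
        ((Real.exp (-(t ^ α / α)) * Real.exp (-(t ^ α / α)) ^ n * Real.exp (-(t ^ α / α)) *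
          Real.exp (-(t ^ α / α)) ^ a : ℝ) : ℂ) := by
      rw [← Real.exp_nat_mul, ← Real.exp_mul, ← Real.exp_add, ← Real.exp_add, ← Real.exp_add,
        Complex.ofReal_exp]
      congr 1
      push_cast
      ring
    rw [hexp, Complex.real_smul]
    push_cast
    ring
  · intro t ht
    have ht0 : t ≠ 0 := (Set.mem_Ioi.1 ht).ne'
    have h := (((Real.hasDerivAt_rpow_const (p := α) (Or.inl ht0)).div_const α).neg).exp
    rw [mul_div_cancel_left₀ _ hα.ne', mul_neg, mul_comm] at h
    exact h.hasDerivWithinAt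
  · intro t ht u _ htu
    have ht0 : 0 ≤ t := (Set.mem_Ioi.1 ht).le
    simp only
    gcongr

/-- Uniqueness: two continuous functions of conformable exponential order with equal
conformable Laplace transforms on a half-line agree on `[0,∞)`. -/
theorem conformableLaplace_uniqueness
    (α : ℝ) (hα0 : 0 < α) (hα1 : α ≤ 1) (f g : ℝ → ℂ)
    (hfc : ContinuousOn f (Set.Ici 0)) (hgc : ContinuousOn g (Set.Ici 0))
    (M a : ℝ) (hM : 0 < M)
    (hfb : ∀ t : ℝ, 0 ≤ t → ‖f t‖ ≤ M * Real.exp (a * (t ^ α / α)))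
    (hgb : ∀ t : ℝ, 0 ≤ t → ‖g t‖ ≤ M * Real.exp (a * (t ^ α / α)))
    (heq : ∀ s : ℝ, a < s →
      ∫ t in Set.Ioi (0 : ℝ),
          Complex.exp (-(s : ℂ) * ((t ^ α / α : ℝ) : ℂ)) * ((t ^ (α - 1) : ℝ) : ℂ) * f t =
      ∫ t in Set.Ioi (0 : ℝ),
          Complex.exp (-(s : ℂ) * ((t ^ α / α : ℝ) : ℂ)) * ((t ^ (α - 1) : ℝ) : ℂ) * g t) :
    ∀ t : ℝ, 0 ≤ t → f t = g t := by
  have hF := continuousOn_conformablePullback hα0 hfc hfb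
  have hG := continuousOn_conformablePullback hα0 hgc hgb
  have hint {H : ℝ → ℂ} (hH : ContinuousOn H (Set.Icc 0 1)) (n : ℕ) :
      IntervalIntegrable (fun x : ℝ => ((x ^ n : ℝ) : ℂ) * H x) volume 0 1 := by
    refine ContinuousOn.intervalIntegrable ?_
    rw [Set.uIcc_of_le zero_le_one]
    exact (by fun_prop : Continuous fun x : ℝ => ((x ^ n : ℝ) : ℂ)).continuousOn.mul hH
  have hzero := eq_zero_of_complex_moments_eq_zero (hF.sub hG) fun n => by
    have hn : (0 : ℝ) ≤ n := n.cast_nonneg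
    simp only [Pi.sub_apply, mul_sub]
    rw [intervalIntegral.integral_sub (hint hF n) (hint hG n),
      integral_pow_mul_conformablePullback a f hα0 n,
      integral_pow_mul_conformablePullback a g hα0 n, heq (a + 2 + n) (by linarith), sub_self]
  intro t ht
  have hexp : 0 < Real.exp (-(t ^ α / α)) := Real.exp_pos _
  have hle : Real.exp (-(t ^ α / α)) ≤ 1 :=
    Real.exp_le_one_iff.2 (neg_nonpos.2 (div_nonneg (Real.rpow_nonneg ht α) hα0.le))
  have h := hzero _ ⟨hexp.le, hle⟩
  simp only [Pi.sub_apply, sub_eq_zero, conformablePullback, rpow_inv_conformable hα0 ht] at h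
  exact mul_left_cancel₀ (Complex.ofReal_ne_zero.2 (Real.rpow_pos_of_pos hexp a).ne')
    (mul_left_cancel₀ (Complex.ofReal_ne_zero.2 hexp.ne') h)
end

section
/- (Initial value theorem) Let 0 < α ≤ 1 and let f : [0,∞) → ℂ be measurable, continuous from the right at 0, and suppose there are constants M > 0 and a ∈ ℝ with |f(t)| ≤ M·exp(a·t^α/α) for all t ≥ 0. Then lim_{s → ∞, s real} s·∫₀^∞ exp(−s·t^α/α)·t^(α−1)·f(t) dt = f(0); that is, lim_{t → 0⁺} f(t) = lim_{s → ∞} s·F_α(s) where F_α = L_0^α{f}. -/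
open MeasureTheory Filter Topology

/-- The substitution `v = s·t^α/α` in the conformable Laplace integral. -/
lemma mul_conformableLaplace_eq_integral {α : ℝ} (hα : 0 < α) (f : ℝ → ℂ) {s : ℝ} (hs : 0 < s) :
    (s : ℂ) * ∫ t in Set.Ioi (0 : ℝ),
        Complex.exp (-(s : ℂ) * ((t ^ α / α : ℝ) : ℂ)) * ((t ^ (α - 1) : ℝ) : ℂ) * f t =
      ∫ v in Set.Ioi (0 : ℝ), (Real.exp (-v) : ℂ) * f ((v * (α / s)) ^ α⁻¹) := by
  have hc : 0 < s / α := by positivity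
  have h := integral_comp_mul_left_Ioi'
    (fun v : ℝ => (Real.exp (-v) : ℂ) * f ((v * (α / s)) ^ α⁻¹)) 0 hc
  rw [mul_zero] at h
  rw [← h, ← integral_comp_rpow_Ioi_of_pos hα (g := fun x : ℝ =>
    (Real.exp (-(s / α * x)) : ℂ) * f ((s / α * x * (α / s)) ^ α⁻¹)), ← integral_const_mul, ← integral_smul]
  refine setIntegral_congr_fun measurableSet_Ioi fun t ht => ?_
  have ht' : (0 : ℝ) < t := ht
  have h1 : (s / α * t ^ α * (α / s)) ^ α⁻¹ = t := by
    rw [show s / α * t ^ α * (α / s) = t ^ α by field_simp, Real.rpow_rpow_inv ht'.le hα.ne']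
  have h2 : -(s / α * t ^ α) = -s * (t ^ α / α) := by ring
  have hα' : (α : ℂ) ≠ 0 := by exact_mod_cast hα.ne'
  simp only [h1, h2, Complex.real_smul]
  push_cast
  field_simp

/-- Initial value theorem: `lim_{s → ∞} s·F_α(s) = f(0) = lim_{t → 0⁺} f(t)` for a
measurable function of conformable exponential order, right-continuous at `0`. -/
theorem conformableLaplace_initial_value
    (α : ℝ) (hα0 : 0 < α) (hα1 : α ≤ 1) (f : ℝ → ℂ) (hf : Measurable f)
    (hf0 : ContinuousWithinAt f (Set.Ici 0) 0)
    (M a : ℝ) (hM : 0 < M)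
    (hbound : ∀ t : ℝ, 0 ≤ t → ‖f t‖ ≤ M * Real.exp (a * (t ^ α / α))) :
    Tendsto
      (fun s : ℝ => (s : ℂ) *
        ∫ t in Set.Ioi (0 : ℝ),
          Complex.exp (-(s : ℂ) * ((t ^ α / α : ℝ) : ℂ)) * ((t ^ (α - 1) : ℝ) : ℂ) * f t)
      atTop (𝓝 (f 0)) := by
  have hlim : ∫ v in Set.Ioi (0 : ℝ), (Real.exp (-v) : ℂ) * f 0 = f 0 := by
    rw [integral_mul_const, integral_complex_ofReal, integral_exp_neg_Ioi_zero]
    simp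
  have key : Tendsto
      (fun s : ℝ => ∫ v in Set.Ioi (0 : ℝ), (Real.exp (-v) : ℂ) * f ((v * (α / s)) ^ α⁻¹))
      atTop (𝓝 (∫ v in Set.Ioi (0 : ℝ), (Real.exp (-v) : ℂ) * f 0)) := by
    refine tendsto_integral_filter_of_dominated_convergence
      (fun v => M * Real.exp (-(1 / 2) * v)) (Eventually.of_forall fun s => ?_) ?_
      ((exp_neg_integrableOn_Ioi 0 (by norm_num : (0 : ℝ) < 1 / 2)).const_mul M) ?_
    · exact Measurable.aestronglyMeasurable (by fun_prop)
    · filter_upwards [eventually_gt_atTop 0, eventually_ge_atTop (2 * a)] with s hs hsa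
      refine (ae_restrict_iff' measurableSet_Ioi).2 (Eventually.of_forall fun v hv => ?_)
      have hv' : (0 : ℝ) < v := hv
      have hb := hbound ((v * (α / s)) ^ α⁻¹) (by positivity)
      rw [Real.rpow_inv_rpow (by positivity) hα0.ne',
        show v * (α / s) / α = v / s by field_simp] at hb
      rw [norm_mul, Complex.norm_real, Real.norm_eq_abs, Real.abs_exp]
      calc Real.exp (-v) * ‖f ((v * (α / s)) ^ α⁻¹)‖
          ≤ Real.exp (-v) * (M * Real.exp (a * (v / s))) := by gcongr
        _ = M * Real.exp (-v + a * (v / s)) := by rw [Real.exp_add]; ring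
        _ ≤ M * Real.exp (-(1 / 2) * v) := by
          gcongr
          have : a * (v / s) ≤ v / 2 := by
            rw [← mul_div_assoc, div_le_div_iff₀ hs two_pos]
            nlinarith
          linarith
    · refine (ae_restrict_iff' measurableSet_Ioi).2 (Eventually.of_forall fun v hv => ?_)
      have hv' : (0 : ℝ) < v := hv
      refine Tendsto.const_mul _ (hf0.tendsto.comp (tendsto_nhdsWithin_iff.2 ⟨?_, ?_⟩))
      · have h0 : Tendsto (fun s : ℝ => v * (α / s)) atTop (𝓝 0) := by
          simpa using (tendsto_id.const_div_atTop α).const_mul v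
        simpa [Real.zero_rpow (inv_ne_zero hα0.ne')] using
          h0.rpow_const (Or.inr (inv_nonneg.2 hα0.le))
      · filter_upwards [eventually_gt_atTop 0] with s hs
        exact Real.rpow_nonneg (by positivity) _
  rw [hlim] at key
  refine key.congr' ?_
  filter_upwards [eventually_gt_atTop 0] with s hs
  exact (mul_conformableLaplace_eq_integral hα0 f hs).symm
end

section
/- (Final value theorem) Let 0 < α ≤ 1 and let f : [0,∞) → ℂ be a bounded measurable function such that f(t) → L as t → ∞ for some L ∈ ℂ. Then lim_{s → 0⁺, s real} s·∫₀^∞ exp(−s·t^α/α)·t^(α−1)·f(t) dt = L; that is, lim_{t → ∞} f(t) = lim_{s → 0⁺} s·F_α(s) where F_α = L_0^α{f}. -/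
open MeasureTheory Filter Topology

/-- The substitution `u = s * t ^ α / α` turns the conformable Laplace integral into an integral
against the exponential density. -/
lemma mul_conformableLaplace_eq_integral_exp {α s : ℝ} (hα : 0 < α) (hs : 0 < s) (f : ℝ → ℂ) :
    (s : ℂ) * ∫ t in Set.Ioi (0 : ℝ),
        Complex.exp (-(s : ℂ) * ((t ^ α / α : ℝ) : ℂ)) * ((t ^ (α - 1) : ℝ) : ℂ) * f t =
      ∫ u in Set.Ioi (0 : ℝ), Real.exp (-u) • f ((α / s * u) ^ α⁻¹) := by
  have hpow := integral_comp_rpow_Ioi_of_pos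
    (g := fun y => Real.exp (-(s / α * y)) • f ((α / s * (s / α * y)) ^ α⁻¹)) hα
  have hscale := integral_comp_mul_left_Ioi'
    (fun u => Real.exp (-u) • f ((α / s * u) ^ α⁻¹)) 0 (div_pos hs hα)
  rw [mul_zero] at hscale
  rw [← hscale, ← hpow, ← integral_const_mul, ← integral_smul]
  refine setIntegral_congr_fun measurableSet_Ioi fun t ht => ?_
  have ht : 0 < t := ht
  have h1 : α / s * (s / α * t ^ α) = t ^ α := by field_simp
  have h2 : -(s : ℂ) * ((t ^ α / α : ℝ) : ℂ) = ((-(s / α * t ^ α) : ℝ) : ℂ) := by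
    push_cast; ring
  have hα' : (α : ℂ) ≠ 0 := by exact_mod_cast hα.ne'
  simp only [h1, h2, Real.rpow_rpow_inv ht.le hα.ne', Complex.real_smul, Complex.ofReal_exp]
  rw [Complex.ofReal_mul α, Complex.ofReal_div]
  field_simp

/-- Final value theorem: if the bounded measurable function `f` tends to `L` at infinity,
then `lim_{s → 0⁺} s·F_α(s) = L = lim_{t → ∞} f(t)`. -/
theorem conformableLaplace_final_value
    (α : ℝ) (hα0 : 0 < α) (hα1 : α ≤ 1) (f : ℝ → ℂ) (hf : Measurable f)
    (C : ℝ) (hbound : ∀ t : ℝ, 0 ≤ t → ‖f t‖ ≤ C)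
    (L : ℂ) (hlim : Tendsto f atTop (𝓝 L)) :
    Tendsto
      (fun s : ℝ => (s : ℂ) *
        ∫ t in Set.Ioi (0 : ℝ),
          Complex.exp (-(s : ℂ) * ((t ^ α / α : ℝ) : ℂ)) * ((t ^ (α - 1) : ℝ) : ℂ) * f t)
      (𝓝[>] (0 : ℝ)) (𝓝 L) := by
  have hL : ∫ u in Set.Ioi (0 : ℝ), Real.exp (-u) • L = L := by
    rw [integral_smul_const, integral_exp_neg_Ioi_zero, one_smul]
  have key : Tendsto
      (fun s : ℝ => ∫ u in Set.Ioi (0 : ℝ), Real.exp (-u) • f ((α / s * u) ^ α⁻¹))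
      (𝓝[>] (0 : ℝ)) (𝓝 (∫ u in Set.Ioi (0 : ℝ), Real.exp (-u) • L)) := by
    refine tendsto_integral_filter_of_dominated_convergence (fun u => Real.exp (-u) * C) ?_ ?_ ?_ ?_
    · refine Eventually.of_forall fun s => Measurable.aestronglyMeasurable ?_
      fun_prop
    · filter_upwards [self_mem_nhdsWithin] with s hs
      have hs : 0 < s := hs
      filter_upwards [ae_restrict_mem measurableSet_Ioi] with u hu
      have hu : 0 < u := hu
      rw [norm_smul, Real.norm_of_nonneg (Real.exp_pos _).le]
      gcongr
      exact hbound _ (by positivity)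
    · exact (integrableOn_exp_neg_Ioi 0).mul_const C
    · filter_upwards [ae_restrict_mem measurableSet_Ioi] with u hu
      refine (hlim.comp ?_).const_smul _
      refine (tendsto_rpow_atTop (inv_pos.mpr hα0)).comp ?_
      simp only [div_eq_mul_inv]
      exact (tendsto_inv_nhdsGT_zero.const_mul_atTop hα0).atTop_mul_const hu
  rw [hL] at key
  refine key.congr' ?_
  filter_upwards [self_mem_nhdsWithin] with s hs
  exact (mul_conformableLaplace_eq_integral_exp hα0 hs f).symm
end

section
/- (Complex inversion formula) Let 0 < α ≤ 1 and let f : [0,∞) → ℂ be continuous with |f(t)| ≤ M·exp(a·t^α/α) for all t ≥ 0, for some constants M > 0 and a ∈ ℝ. Let F_α(s) = ∫₀^∞ exp(−s·t^α/α)·t^(α−1)·f(t) dt for Re(s) > a, fix a real c > a, and suppose that y ↦ F_α(c + i·y) is Lebesgue integrable on ℝ. Then for every t > 0, f(t) = (1/(2π))·∫_ℝ exp((c + i·y)·t^α/α)·F_α(c + i·y) dy. (This is the Bromwich integral f(t) = (1/(2πi))·∫_{c−i∞}^{c+i∞} e^{s·t^α/α}·F_α(s) ds.) -/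
open MeasureTheory

open scoped FourierTransform in
/-- The Laplace transform on the vertical line `re z = c` is a Fourier transform. -/
theorem fourier_indicator_exp_mul_eq_laplace (g : ℝ → ℂ) (c w : ℝ) :
    𝓕 ((Set.Ioi (0 : ℝ)).indicator fun u => Complex.exp (-(c : ℂ) * u) * g u) w =
      ∫ u in Set.Ioi (0 : ℝ),
        Complex.exp (-((c : ℂ) + ((2 * Real.pi * w : ℝ) : ℂ) * Complex.I) * u) * g u := by
  rw [Real.fourier_eq', ← integral_indicator measurableSet_Ioi]
  congr 1 with u
  by_cases hu : u ∈ Set.Ioi (0 : ℝ)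
  · simp only [Set.indicator_of_mem hu, smul_eq_mul, ← mul_assoc, ← Complex.exp_add]
    congr 2
    simp
    ring
  · simp [Set.indicator_of_notMem hu]

open scoped FourierTransform in
/-- The Bromwich inversion formula for the Laplace transform at a continuity point. -/
theorem laplace_complex_inversion (g : ℝ → ℂ) (c : ℝ) (L : ℂ → ℂ)
    (hL : ∀ y : ℝ, L ((c : ℂ) + y * Complex.I) =
      ∫ u in Set.Ioi (0 : ℝ), Complex.exp (-((c : ℂ) + y * Complex.I) * u) * g u)
    (hg : IntegrableOn (fun u : ℝ => Complex.exp (-(c : ℂ) * u) * g u) (Set.Ioi 0))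
    (hint : Integrable fun y : ℝ => L ((c : ℂ) + y * Complex.I))
    {u : ℝ} (hu : 0 < u) (hgu : ContinuousAt g u) :
    g u = (1 / (2 * Real.pi) : ℝ) •
      ∫ y : ℝ, Complex.exp (((c : ℂ) + y * Complex.I) * u) * L ((c : ℂ) + y * Complex.I) := by
  set h : ℝ → ℂ := (Set.Ioi (0 : ℝ)).indicator fun u => Complex.exp (-(c : ℂ) * u) * g u with hh
  have hpi : (2 * Real.pi) ≠ 0 := by positivity
  have hFh (w : ℝ) : 𝓕 h w = L ((c : ℂ) + ((2 * Real.pi * w : ℝ) : ℂ) * Complex.I) := by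
    rw [hh, fourier_indicator_exp_mul_eq_laplace, hL]
  have hFint : Integrable (𝓕 h) := by
    rw [funext hFh]
    exact hint.comp_mul_left' hpi
  have hcont : ContinuousAt h u := by
    refine ContinuousAt.congr (f := fun u : ℝ => Complex.exp (-(c : ℂ) * u) * g u)
      (ContinuousAt.mul (by fun_prop) hgu) ?_
    filter_upwards [Ioi_mem_nhds hu] with v hv
    exact (Set.indicator_of_mem hv (fun u : ℝ => Complex.exp (-(c : ℂ) * u) * g u)).symm
  have hinv : 𝓕⁻ (𝓕 h) u = h u :=
    (hg.integrable_indicator measurableSet_Ioi).fourierInv_fourier_eq hFint hcont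
  have hhu : h u = Complex.exp (-(c : ℂ) * u) * g u := Set.indicator_of_mem hu _
  have hscale := Measure.integral_comp_mul_left
    (fun y : ℝ => Complex.exp (((c : ℂ) + y * Complex.I) * u) * L ((c : ℂ) + y * Complex.I))
    (2 * Real.pi)
  rw [abs_of_pos (by positivity), ← one_div] at hscale
  rw [← hscale]
  calc g u = Complex.exp (c * u) * h u := by
        rw [hhu, ← mul_assoc, ← Complex.exp_add]
        simp
    _ = _ := by
        rw [← hinv, Real.fourierInv_eq', ← integral_const_mul]
        congr 1 with w
        rw [hFh, smul_eq_mul, ← mul_assoc, ← Complex.exp_add]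
        congr 2
        simp
        ring

theorem image_rpow_div_Ioi {α : ℝ} (hα : 0 < α) :
    (fun t : ℝ => t ^ α / α) '' Set.Ioi 0 = Set.Ioi 0 := by
  ext u
  simp only [Set.mem_image, Set.mem_Ioi]
  constructor
  · rintro ⟨t, ht, rfl⟩
    positivity
  · intro hu
    refine ⟨(α * u) ^ α⁻¹, by positivity, ?_⟩
    rw [Real.rpow_inv_rpow (by positivity) hα.ne']
    field_simp

theorem mul_rpow_div_rpow_inv {α t : ℝ} (hα : 0 < α) (ht : 0 ≤ t) :
    (α * (t ^ α / α)) ^ α⁻¹ = t := by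
  rw [mul_div_cancel₀ _ hα.ne', Real.rpow_rpow_inv ht hα.ne']

/-- The substitution `u = t ^ α / α` on the half-line. -/
theorem integral_comp_rpow_div_Ioi {α : ℝ} (hα : 0 < α) (k : ℝ → ℂ) :
    ∫ u in Set.Ioi (0 : ℝ), k u =
      ∫ t in Set.Ioi (0 : ℝ), ((t ^ (α - 1) : ℝ) : ℂ) * k (t ^ α / α) := by
  have hinj : Set.InjOn (fun t : ℝ => t ^ α / α) (Set.Ioi 0) := fun s hs t ht hst => by
    rw [← mul_rpow_div_rpow_inv hα (le_of_lt hs), ← mul_rpow_div_rpow_inv hα (le_of_lt ht)]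
    exact congrArg (fun v => (α * v) ^ α⁻¹) hst
  have hderiv : ∀ t ∈ Set.Ioi (0 : ℝ),
      HasDerivWithinAt (fun t : ℝ => t ^ α / α) (t ^ (α - 1)) (Set.Ioi 0) t := fun t ht => by
    have := ((Real.hasDerivAt_rpow_const (p := α) (Or.inl (ne_of_gt ht))).div_const α)
    rw [mul_div_cancel_left₀ _ hα.ne'] at this
    exact this.hasDerivWithinAt
  conv_lhs => rw [← image_rpow_div_Ioi hα]
  rw [integral_image_eq_integral_abs_deriv_smul measurableSet_Ioi hderiv hinj]
  refine setIntegral_congr_fun measurableSet_Ioi fun t ht => ?_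
  simp only [abs_of_pos (Real.rpow_pos_of_pos ht _), Complex.real_smul]

/-- A function of exponential order `a` has a convergent Laplace integral at every `c > a`. -/
theorem integrableOn_exp_mul_of_exponential_order {g : ℝ → ℂ} {M a c : ℝ}
    (hg : ContinuousOn g (Set.Ioi 0)) (hbound : ∀ u : ℝ, 0 < u → ‖g u‖ ≤ M * Real.exp (a * u))
    (hc : a < c) :
    IntegrableOn (fun u : ℝ => Complex.exp (-(c : ℂ) * u) * g u) (Set.Ioi 0) := by
  have hdom : IntegrableOn (fun u : ℝ => M * Real.exp (-(c - a) * u)) (Set.Ioi 0) :=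
    (exp_neg_integrableOn_Ioi 0 (sub_pos.2 hc)).const_mul M
  refine Integrable.mono' hdom (ContinuousOn.aestronglyMeasurable
    (ContinuousOn.mul (by fun_prop) hg) measurableSet_Ioi) ?_
  filter_upwards [ae_restrict_mem measurableSet_Ioi] with u hu
  calc ‖Complex.exp (-(c : ℂ) * u) * g u‖
      = Real.exp (-c * u) * ‖g u‖ := by simp [Complex.norm_exp]
    _ ≤ Real.exp (-c * u) * (M * Real.exp (a * u)) := by gcongr; exact hbound u hu
    _ = M * Real.exp (-(c - a) * u) := by
        rw [mul_left_comm, ← Real.exp_add]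
        ring_nf

/-- Complex inversion (Bromwich) formula for the conformable Laplace transform:
for continuous `f` of conformable exponential order `a`, any `c > a` with
`y ↦ F_α(c + iy)` integrable, and `t > 0`,
`f(t) = (1/(2π))·∫_ℝ e^{(c+iy)·t^α/α} F_α(c+iy) dy`. -/
theorem conformableLaplace_complex_inversion
    (α : ℝ) (hα0 : 0 < α) (hα1 : α ≤ 1) (f : ℝ → ℂ)
    (hcont : ContinuousOn f (Set.Ici 0)) (M a : ℝ) (hM : 0 < M)
    (hbound : ∀ t : ℝ, 0 ≤ t → ‖f t‖ ≤ M * Real.exp (a * (t ^ α / α)))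
    (F : ℂ → ℂ)
    (hF : ∀ z : ℂ, a < z.re →
      F z = ∫ t in Set.Ioi (0 : ℝ),
        Complex.exp (-z * ((t ^ α / α : ℝ) : ℂ)) * ((t ^ (α - 1) : ℝ) : ℂ) * f t)
    (c : ℝ) (hc : a < c)
    (hint : Integrable (fun y : ℝ => F ((c : ℂ) + y * Complex.I))) :
    ∀ t : ℝ, 0 < t →
      f t = (1 / (2 * Real.pi) : ℝ) •
        ∫ y : ℝ,
          Complex.exp (((c : ℂ) + y * Complex.I) * ((t ^ α / α : ℝ) : ℂ)) *
            F ((c : ℂ) + y * Complex.I) := by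
  intro t ht
  set g : ℝ → ℂ := fun u => f ((α * u) ^ α⁻¹)
  have hgt (t : ℝ) (ht : 0 ≤ t) : g (t ^ α / α) = f t :=
    congrArg f (mul_rpow_div_rpow_inv hα0 ht)
  have hgcont : ContinuousOn g (Set.Ioi 0) := by
    refine hcont.comp (ContinuousOn.rpow_const (by fun_prop) fun u _ => Or.inr (by positivity)) ?_
    intro u hu
    have : 0 < u := hu
    exact Set.mem_Ici.2 (by positivity)
  have hgbound (u : ℝ) (hu : 0 < u) : ‖g u‖ ≤ M * Real.exp (a * u) := by
    have := hbound ((α * u) ^ α⁻¹) (by positivity)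
    rwa [Real.rpow_inv_rpow (by positivity) hα0.ne', mul_div_cancel_left₀ _ hα0.ne'] at this
  have hFg (y : ℝ) : F ((c : ℂ) + y * Complex.I) =
      ∫ u in Set.Ioi (0 : ℝ), Complex.exp (-((c : ℂ) + y * Complex.I) * u) * g u := by
    rw [hF _ (by simpa using hc), integral_comp_rpow_div_Ioi hα0 (fun u : ℝ =>
      Complex.exp (-((c : ℂ) + y * Complex.I) * u) * g u)]
    refine setIntegral_congr_fun measurableSet_Ioi fun s hs => ?_
    simp only [hgt s (le_of_lt hs)]
    ring
  have hu : 0 < t ^ α / α := by positivity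
  rw [← hgt t ht.le]
  exact laplace_complex_inversion g c F hFg
    (integrableOn_exp_mul_of_exponential_order hgcont hgbound hc) hint hu
    (hgcont.continuousAt (Ioi_mem_nhds hu))
end

section
/- (Conformable convolution theorem) Let 0 < α ≤ 1, let f, g : (0,∞) → ℂ be measurable, and let s ∈ ℂ be such that t ↦ exp(−Re(s)·t^α/α)·t^(α−1)·|f(t)| and t ↦ exp(−Re(s)·t^α/α)·t^(α−1)·|g(t)| are Lebesgue integrable on (0,∞). Then (∫₀^∞ exp(−s·t^α/α)·t^(α−1)·f(t) dt)·(∫₀^∞ exp(−s·t^α/α)·t^(α−1)·g(t) dt) = ∫₀^∞ exp(−s·t^α/α)·t^(α−1)·(f *_α g)(t) dt; that is, L_0^α{f}(s)·L_0^α{g}(s) = L_0^α{f *_α g}(s). -/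
open MeasureTheory

/-- Conformable fractional convolution of complex-valued functions:
`(f *_α g)(t) = ∫₀^t f(p)·g((t^α − p^α)^(1/α))·p^(α−1) dp`. -/
noncomputable def conformableConv (α : ℝ) (f g : ℝ → ℂ) (t : ℝ) : ℂ :=
  ∫ p in Set.Ioo 0 t, f p * g ((t ^ α - p ^ α) ^ (1 / α)) * ((p ^ (α - 1) : ℝ) : ℂ)

open Set

/-- The substitution `u = t ^ α` on the half-line, with the Jacobian factor `α` moved outside. -/
theorem integral_Ioi_rpow_sub_one_mul_comp_rpow {α : ℝ} (hα : 0 < α) (h : ℝ → ℂ) :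
    ∫ t in Ioi (0 : ℝ), ((t ^ (α - 1) : ℝ) : ℂ) * h (t ^ α) =
      (α : ℂ)⁻¹ * ∫ u in Ioi (0 : ℝ), h u := by
  rw [← integral_comp_rpow_Ioi_of_pos (g := h) hα, ← integral_const_mul]
  refine integral_congr_ae (.of_forall fun t => ?_)
  have : (α : ℂ) ≠ 0 := by exact_mod_cast hα.ne'
  simp only [Complex.real_smul, Complex.ofReal_mul]
  field_simp

/-- In the variable `u = t ^ α`, the conformable Laplace transform is an ordinary one. -/
theorem conformableLaplace_eq_integral {α : ℝ} (hα : 0 < α) (f : ℝ → ℂ) (s : ℂ) :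
    ∫ t in Ioi (0 : ℝ),
        Complex.exp (-s * ((t ^ α / α : ℝ) : ℂ)) * ((t ^ (α - 1) : ℝ) : ℂ) * f t =
      (α : ℂ)⁻¹ * ∫ u in Ioi (0 : ℝ),
        Complex.exp (-s * ((u / α : ℝ) : ℂ)) * f (u ^ (1 / α)) := by
  rw [← integral_Ioi_rpow_sub_one_mul_comp_rpow hα]
  refine setIntegral_congr_fun measurableSet_Ioi fun t ht => ?_
  have ht' : (t ^ α) ^ (1 / α) = t := by
    rw [one_div, Real.rpow_rpow_inv (le_of_lt ht) hα.ne']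
  simp only [ht']
  ring

/-- Absolute convergence of the conformable Laplace transform, in the variable `u = t ^ α`. -/
theorem integrableOn_exp_mul_comp_rpow {α : ℝ} (hα : 0 < α) {f : ℝ → ℂ} (hf : Measurable f)
    {s : ℂ}
    (hfint : IntegrableOn
      (fun t : ℝ => Real.exp (-s.re * (t ^ α / α)) * t ^ (α - 1) * ‖f t‖) (Ioi 0)) :
    IntegrableOn
      (fun u : ℝ => Complex.exp (-s * ((u / α : ℝ) : ℂ)) * f (u ^ (1 / α))) (Ioi 0) := by
  rw [← integrableOn_Ioi_comp_rpow_iff' _ hα.ne']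
  refine Integrable.mono hfint (by fun_prop) ?_
  filter_upwards [ae_restrict_mem measurableSet_Ioi] with t ht
  have ht' : (t ^ α) ^ (1 / α) = t := by
    rw [one_div, Real.rpow_rpow_inv (le_of_lt ht) hα.ne']
  rw [ht', norm_smul, norm_mul, norm_mul, norm_mul, Complex.norm_exp, Complex.re_mul_ofReal,
    Complex.neg_re, norm_norm, Real.norm_of_nonneg (Real.exp_pos _).le]
  exact le_of_eq (by ring)

/-- In the variables `u = t ^ α` and `v = p ^ α`, the conformable convolution is an ordinary one. -/
theorem conformableConv_rpow_one_div {α : ℝ} (hα : 0 < α) (f g : ℝ → ℂ) {u : ℝ} (hu : 0 < u) :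
    conformableConv α f g (u ^ (1 / α)) =
      (α : ℂ)⁻¹ * ∫ v in (0 : ℝ)..u, f (v ^ (1 / α)) * g ((u - v) ^ (1 / α)) := by
  have hIoo : ∀ w : ℝ, Ioo 0 w = Ioi 0 ∩ Iio w := fun w => Ioi_inter_Iio.symm
  rw [conformableConv, intervalIntegral.integral_of_le hu.le, integral_Ioc_eq_integral_Ioo,
    hIoo, hIoo, ← setIntegral_indicator measurableSet_Iio, ← setIntegral_indicator measurableSet_Iio,
    ← integral_Ioi_rpow_sub_one_mul_comp_rpow hα]
  refine setIntegral_congr_fun measurableSet_Ioi fun p hp => ?_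
  have hp' : (p ^ α) ^ (1 / α) = p := by
    rw [one_div, Real.rpow_rpow_inv (le_of_lt hp) hα.ne']
  have hu' : (u ^ (1 / α)) ^ α = u := by
    rw [one_div, Real.rpow_inv_rpow hu.le hα.ne']
  have hlt : p < u ^ (1 / α) ↔ p ^ α < u := by
    rw [one_div, Real.lt_rpow_inv_iff_of_pos (le_of_lt hp) hu.le hα]
  by_cases h : p ^ α < u
  · simp only [indicator, mem_Iio, hlt, h, if_true, hp', hu']
    ring
  · simp only [indicator, mem_Iio, hlt, h, if_false, mul_zero]

/-- Conformable convolution theorem: `L_0^α{f}(s)·L_0^α{g}(s) = L_0^α{f *_α g}(s)`,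
under absolute integrability of both transforms. -/
theorem conformableLaplace_convolution
    (α : ℝ) (hα0 : 0 < α) (hα1 : α ≤ 1) (f g : ℝ → ℂ)
    (hf : Measurable f) (hg : Measurable g) (s : ℂ)
    (hfint : IntegrableOn
      (fun t : ℝ => Real.exp (-s.re * (t ^ α / α)) * t ^ (α - 1) * ‖f t‖)
      (Set.Ioi 0))
    (hgint : IntegrableOn
      (fun t : ℝ => Real.exp (-s.re * (t ^ α / α)) * t ^ (α - 1) * ‖g t‖)
      (Set.Ioi 0)) :
    (∫ t in Set.Ioi (0 : ℝ),
        Complex.exp (-s * ((t ^ α / α : ℝ) : ℂ)) * ((t ^ (α - 1) : ℝ) : ℂ) * f t) *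
    (∫ t in Set.Ioi (0 : ℝ),
        Complex.exp (-s * ((t ^ α / α : ℝ) : ℂ)) * ((t ^ (α - 1) : ℝ) : ℂ) * g t) =
    ∫ t in Set.Ioi (0 : ℝ),
        Complex.exp (-s * ((t ^ α / α : ℝ) : ℂ)) * ((t ^ (α - 1) : ℝ) : ℂ) *
          conformableConv α f g t := by
  rw [conformableLaplace_eq_integral hα0, conformableLaplace_eq_integral hα0,
    conformableLaplace_eq_integral hα0]
  have hconv := integral_posConvolution (integrableOn_exp_mul_comp_rpow hα0 hf hfint)
    (integrableOn_exp_mul_comp_rpow hα0 hg hgint) (ContinuousLinearMap.mul ℝ ℂ)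
  simp only [ContinuousLinearMap.mul_apply'] at hconv
  rw [mul_mul_mul_comm, ← hconv, mul_assoc, ← integral_const_mul (α : ℂ)⁻¹]
  congr 1
  refine setIntegral_congr_fun measurableSet_Ioi fun u hu => ?_
  rw [conformableConv_rpow_one_div hα0 f g hu, mul_left_comm,
    ← intervalIntegral.integral_const_mul (Complex.exp _)]
  congr 1
  refine intervalIntegral.integral_congr fun v _ => ?_
  have hexp : Complex.exp (-s * ((u / α : ℝ) : ℂ)) =
      Complex.exp (-s * ((v / α : ℝ) : ℂ)) * Complex.exp (-s * (((u - v) / α : ℝ) : ℂ)) := by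
    rw [← Complex.exp_add]
    push_cast
    ring_nf
  simp only [hexp]
  ring
end
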